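/- arXiv:2006.14224 — 3 statements merged into one kernel-verified Lean document; each statement's English description precedes it below -/
import Mathlib

section
/- Let s : ℝ → ℝ be differentiable at every point of (0, +∞), and suppose that s(α) → +∞ as α → 0⁺ and s(α) → +∞ as α → +∞. Assume that every critical point of s in (0, +∞) is a strict local minimum point, i.e. for every α > 0 with s'(α) = 0 there exists δ > 0 such that s(β) > s(α) for all β ∈ (0, +∞) with 0 < |β − α| < δ. Then there exists a unique α* > 0 such that s(α*) ≤ s(β) for all β > 0, and moreover s(β) > s(α*) for every β > 0 with β ≠ α*. -/
/-- A strict local minimum point in `(0,∞)` is not a local maximum point. -/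
lemma not_isLocalMax_of_strict_local_min {s : ℝ → ℝ} {c : ℝ} (hc : 0 < c)
    (h : ∃ δ > 0, ∀ β : ℝ, 0 < β → β ≠ c → |β - c| < δ → s c < s β) : ¬ IsLocalMax s c := by
  obtain ⟨δ, hδ, h⟩ := h
  intro hmax
  obtain ⟨ε, hε, hball⟩ := Metric.eventually_nhds_iff.1 hmax
  have hpos : 0 < min δ ε / 2 := by positivity
  have habs : |c + min δ ε / 2 - c| = min δ ε / 2 := by
    rw [add_sub_cancel_left, abs_of_pos hpos]
  have h₁ := h (c + min δ ε / 2) (by linarith) (by linarith)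
    (by rw [habs]; linarith [min_le_left δ ε])
  have h₂ : s (c + min δ ε / 2) ≤ s c :=
    hball (by rw [Real.dist_eq, habs]; linarith [min_le_right δ ε])
  linarith

/-- If every critical point in `(0,∞)` is a strict local minimum point, then two distinct points
cannot both be global minimum points on `(0,∞)`. -/
lemma not_lt_of_global_min {s : ℝ → ℝ}
    (hdiff : ∀ α : ℝ, 0 < α → DifferentiableAt ℝ s α)
    (hcrit : ∀ α : ℝ, 0 < α → deriv s α = 0 →
      ∃ δ > 0, ∀ β : ℝ, 0 < β → β ≠ α → |β - α| < δ → s α < s β)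
    {a b : ℝ} (ha : 0 < a) (hmin_a : ∀ β : ℝ, 0 < β → s a ≤ s β)
    (hmin_b : ∀ β : ℝ, 0 < β → s b ≤ s β) : ¬ a < b := by
  intro hab
  have hb : 0 < b := ha.trans hab
  have hloc : IsLocalMin s a := by
    filter_upwards [lt_mem_nhds ha] with x hx using hmin_a x hx
  obtain ⟨δ, hδ, hstrict⟩ := hcrit a ha hloc.deriv_eq_zero
  obtain ⟨c, hc, hmax⟩ := isCompact_Icc.exists_isMaxOn (Set.nonempty_Icc.2 hab.le)
    (fun x hx => (hdiff x (ha.trans_le hx.1)).continuousAt.continuousWithinAt)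
  have hc0 : 0 < c := ha.trans_le hc.1
  have hlt : s a < s c := by
    have hpos : 0 < min (δ / 2) (b - a) := lt_min (by positivity) (by linarith)
    have h₁ := hstrict (a + min (δ / 2) (b - a)) (by linarith) (by linarith)
      (by rw [add_sub_cancel_left, abs_of_pos hpos]; linarith [min_le_left (δ / 2) (b - a)])
    exact h₁.trans_le (hmax ⟨by linarith, by linarith [min_le_right (δ / 2) (b - a)]⟩)
  have hac : a < c := lt_of_le_of_ne hc.1 (by rintro rfl; exact hlt.false)
  have hcb : c < b := lt_of_le_of_ne hc.2 (by rintro rfl; linarith [hmin_b a ha])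
  have hlocmax : IsLocalMax s c := hmax.isLocalMax (Icc_mem_nhds hac hcb)
  exact not_isLocalMax_of_strict_local_min hc0 (hcrit c hc0 hlocmax.deriv_eq_zero) hlocmax

/-- A function continuous on `(0,∞)` that tends to `+∞` at `0⁺` and at `+∞` attains its minimum. -/
lemma exists_global_min_of_tendsto_atTop {s : ℝ → ℝ}
    (hcont : ∀ α : ℝ, 0 < α → ContinuousAt s α)
    (h0 : Filter.Tendsto s (nhdsWithin 0 (Set.Ioi 0)) Filter.atTop)
    (hinf : Filter.Tendsto s Filter.atTop Filter.atTop) :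
    ∃ a : ℝ, 0 < a ∧ ∀ β : ℝ, 0 < β → s a ≤ s β := by
  obtain ⟨u, hu, hsu⟩ := mem_nhdsGT_iff_exists_Ioo_subset.1 (h0.eventually_ge_atTop (s 1))
  obtain ⟨M, hM⟩ := Filter.eventually_atTop.1 (hinf.eventually_ge_atTop (s 1))
  have hu' : 0 < min u 1 := lt_min hu one_pos
  have h1 : (1 : ℝ) ∈ Set.Icc (min u 1) (max M 1) := ⟨min_le_right _ _, le_max_right _ _⟩
  obtain ⟨a, ha, hmin⟩ := isCompact_Icc.exists_isMinOn ⟨1, h1⟩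
    (fun x hx => (hcont x (hu'.trans_le hx.1)).continuousWithinAt)
  refine ⟨a, hu'.trans_le ha.1, fun β hβ => ?_⟩
  rcases lt_or_ge β (min u 1) with hlt | hge
  · exact (hmin h1).trans (hsu ⟨hβ, hlt.trans_le (min_le_left _ _)⟩)
  rcases le_or_gt β (max M 1) with hle | hgt
  · exact hmin ⟨hge, hle⟩
  · exact (hmin h1).trans (hM β ((le_max_left _ _).trans hgt.le))

/-- If `s` is differentiable on `(0,∞)`, tends to `+∞` at `0⁺` and at `+∞`, and
every critical point in `(0,∞)` is a strict local minimum point, then `s` has a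
unique global minimum point `α* > 0`, which is a strict global minimum. -/
theorem stmt_3 (s : ℝ → ℝ)
    (hdiff : ∀ α : ℝ, 0 < α → DifferentiableAt ℝ s α)
    (h0 : Filter.Tendsto s (nhdsWithin 0 (Set.Ioi 0)) Filter.atTop)
    (hinf : Filter.Tendsto s Filter.atTop Filter.atTop)
    (hcrit : ∀ α : ℝ, 0 < α → deriv s α = 0 →
      ∃ δ > 0, ∀ β : ℝ, 0 < β → β ≠ α → |β - α| < δ → s α < s β) :
    ∃ αs : ℝ, 0 < αs ∧ (∀ β : ℝ, 0 < β → s αs ≤ s β) ∧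
      (∀ β : ℝ, 0 < β → β ≠ αs → s αs < s β) ∧
      (∀ α' : ℝ, 0 < α' → (∀ β : ℝ, 0 < β → s α' ≤ s β) → α' = αs) := by
  obtain ⟨a, ha, hmin⟩ :=
    exists_global_min_of_tendsto_atTop (fun α hα => (hdiff α hα).continuousAt) h0 hinf
  have huniq : ∀ α' : ℝ, 0 < α' → (∀ β : ℝ, 0 < β → s α' ≤ s β) → α' = a := fun α' hα' hmin' =>
    le_antisymm (not_lt.1 (not_lt_of_global_min hdiff hcrit ha hmin hmin'))
      (not_lt.1 (not_lt_of_global_min hdiff hcrit hα' hmin' hmin))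
  refine ⟨a, ha, hmin, fun β hβ hne => lt_of_not_ge fun hle => hne ?_, huniq⟩
  exact huniq β hβ fun γ hγ => hle.trans (hmin γ hγ)
end

section
/- Let D > 0, K ≥ 0, η < 0, and let Λ : ℝ → ℝ satisfy Λ(α) ≤ η and Λ(α) ≤ K − D·α² for all α ≥ 0. Then for every α > 0 one has −Λ(α)/α ≥ (−η)·√(D/(K − η)). In particular, ⨅_{α>0} −Λ(α)/α ≥ A·√D with A = (−η)/√(K − η) > 0. -/
/-- If `Λ α ≤ η < 0` and `Λ α ≤ K - D α²` for all `α ≥ 0` (with `D > 0`,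
`K ≥ 0`), then `-Λ α / α ≥ (-η)√(D/(K-η))` for all `α > 0`; in particular
`⨅_{α>0} (-Λ α / α) ≥ A √D` with `A = (-η)/√(K-η)`. -/
theorem stmt_8 (D K η : ℝ) (hD : 0 < D) (hK : 0 ≤ K) (hη : η < 0) (Λ : ℝ → ℝ)
    (h1 : ∀ α : ℝ, 0 ≤ α → Λ α ≤ η)
    (h2 : ∀ α : ℝ, 0 ≤ α → Λ α ≤ K - D * α ^ 2) :
    (∀ α : ℝ, 0 < α → (-η) * Real.sqrt (D / (K - η)) ≤ -Λ α / α) ∧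
      (-η) / Real.sqrt (K - η) * Real.sqrt D
        ≤ ⨅ α : Set.Ioi (0 : ℝ), -Λ (α : ℝ) / (α : ℝ) := by
  have hKη : 0 < K - η := by linarith
  have key : ∀ α : ℝ, 0 < α → (-η) * Real.sqrt (D / (K - η)) ≤ -Λ α / α := by
    intro α hα
    rw [le_div_iff₀ hα, mul_assoc]
    have hsq : (K - η) * (Real.sqrt (D / (K - η)) * α) ^ 2 = D * α ^ 2 := by
      rw [mul_pow, Real.sq_sqrt (by positivity)]
      field_simp
    have hη' := h1 α hα.le
    have hD' := h2 α hα.le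
    set t := Real.sqrt (D / (K - η)) * α
    rcases le_total t 1 with ht | ht
    · nlinarith
    · have hK' : 0 ≤ K * (t ^ 2 - 1) := mul_nonneg hK (by nlinarith)
      have ht' : 0 ≤ (-η) * (t * (t - 1)) :=
        mul_nonneg (by linarith) (mul_nonneg (by linarith) (by linarith))
      nlinarith
  refine ⟨key, le_ciInf fun α => ?_⟩
  have h := key α α.2
  rwa [Real.sqrt_div hD.le, mul_div_assoc', mul_div_right_comm] at h
end

section
/- Let D > 0 and G ≥ 0, and let Λₙ : ℝ → ℝ (n ∈ ℕ) be a sequence of functions, each concave and even with Λₙ(0) < 0, which converges locally uniformly on [0, +∞) to the function α ↦ −D·α² − G. Then the sequence of infima cₙ := ⨅_{α>0} −Λₙ(α)/α converges to 2√(D·G) as n → ∞. -/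
/-- An even concave function on `ℝ` is maximal at `0`. -/
theorem ConcaveOn.le_apply_zero_of_even {f : ℝ → ℝ} (hf : ConcaveOn ℝ Set.univ f)
    (heven : ∀ x, f (-x) = f x) (x : ℝ) : f x ≤ f 0 := by
  have h := hf.2 (Set.mem_univ x) (Set.mem_univ (-x))
    (by norm_num : (0 : ℝ) ≤ 1 / 2) (by norm_num : (0 : ℝ) ≤ 1 / 2) (by norm_num)
  simp only [smul_eq_mul, heven] at h
  rw [show (1 / 2 : ℝ) * x + 1 / 2 * -x = 0 by ring] at h
  linarith

/-- If a concave function is negative at `0` and drops by at least `a * M` between `0` and `M`,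
then it stays below `-a * x` for all `x ≥ M`. -/
theorem ConcaveOn.le_neg_mul_of_drop {f : ℝ → ℝ} (hf : ConcaveOn ℝ Set.univ f)
    {a M x : ℝ} (h0 : f 0 < 0) (hM : 0 < M) (hdrop : a * M ≤ f 0 - f M) (hx : M ≤ x) :
    f x ≤ -a * x := by
  have hx0 : 0 < x := hM.trans_le hx
  have h := hf.2 (Set.mem_univ 0) (Set.mem_univ x)
    (sub_nonneg.2 ((div_le_one hx0).2 hx)) (by positivity : 0 ≤ M / x) (by ring)
  simp only [smul_eq_mul, mul_zero, zero_add, div_mul_cancel₀ _ hx0.ne'] at h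
  have h1 : M / x * (f x - f 0) ≤ M / x * (-a * x) := by
    have : M / x * (-a * x) = -a * M := by field_simp
    rw [this]; linarith
  have h2 := le_of_mul_le_mul_left h1 (by positivity)
  linarith

/-- If each `Λₙ` is concave and even with `Λₙ 0 < 0`, and `Λₙ` converges
locally uniformly on `[0,∞)` to `α ↦ -D α² - G` (with `D > 0`, `G ≥ 0`), then
`cₙ := ⨅_{α>0} (-Λₙ α / α)` converges to `2√(DG)`. -/
theorem stmt_11 (D G : ℝ) (hD : 0 < D) (hG : 0 ≤ G) (Λ : ℕ → ℝ → ℝ)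
    (hconc : ∀ n, ConcaveOn ℝ Set.univ (Λ n))
    (heven : ∀ n, ∀ α : ℝ, Λ n (-α) = Λ n α)
    (hneg : ∀ n, Λ n 0 < 0)
    (hconv : TendstoLocallyUniformlyOn Λ (fun α => -D * α ^ 2 - G)
      Filter.atTop (Set.Ici 0)) :
    Filter.Tendsto (fun n => ⨅ α : Set.Ioi (0 : ℝ), -Λ n (α : ℝ) / (α : ℝ))
      Filter.atTop (nhds (2 * Real.sqrt (D * G))) := by
  have hpos : ∀ n, ∀ α : Set.Ioi (0 : ℝ), 0 ≤ -Λ n (α : ℝ) / (α : ℝ) := fun n α =>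
    div_nonneg (by linarith [(hconc n).le_apply_zero_of_even (heven n) α, hneg n]) α.2.le
  have hs0 : 0 ≤ Real.sqrt (D * G) := Real.sqrt_nonneg _
  have hsq : Real.sqrt (D * G) ^ 2 = D * G := Real.sq_sqrt (by positivity)
  have lower : ∀ a, 0 ≤ a → a < 2 * Real.sqrt (D * G) →
      ∀ᶠ n in Filter.atTop, a ≤ ⨅ α : Set.Ioi (0 : ℝ), -Λ n (α : ℝ) / (α : ℝ) := by
    intro a ha has
    obtain ⟨δ, hδ⟩ : ∃ δ, δ = G - a ^ 2 / (4 * D) := ⟨_, rfl⟩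
    have hδG : 4 * D * δ = 4 * D * G - a ^ 2 := by rw [hδ]; field_simp
    have hδ0 : 0 < δ := by
      have : 0 < 4 * D * δ := by rw [hδG]; nlinarith
      exact pos_of_mul_pos_right this (by positivity)
    obtain ⟨M, hM⟩ : ∃ M, M = a / D + 1 + 2 * δ / D := ⟨_, rfl⟩
    have hDM : D * M = a + D + 2 * δ := by rw [hM]; field_simp
    have hM1 : 1 ≤ M := by
      have : 0 ≤ a / D := by positivity
      have : 0 ≤ 2 * δ / D := by positivity
      linarith
    have hunif := (tendstoLocallyUniformlyOn_iff_tendstoUniformlyOn_of_compact isCompact_Icc).1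
      (hconv.mono (Set.Icc_subset_Ici_self : Set.Icc 0 M ⊆ Set.Ici 0))
    filter_upwards [Metric.tendstoUniformlyOn_iff.1 hunif δ hδ0] with n hn
    refine le_ciInf fun ⟨x, hx⟩ => ?_
    rw [Set.mem_Ioi] at hx
    rw [le_div_iff₀ hx]
    rcases le_total x M with hxM | hxM
    · have h := (abs_lt.1 (hn x ⟨hx.le, hxM⟩)).1
      have hquad : 0 ≤ D * x ^ 2 + G - a * x - δ := by
        refine nonneg_of_mul_nonneg_right (b := D * x ^ 2 + G - a * x - δ) (a := 4 * D) ?_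
          (by positivity)
        nlinarith [sq_nonneg (2 * D * x - a)]
      linarith
    · have hd0 := (abs_lt.1 (hn 0 ⟨le_rfl, by linarith⟩)).2
      have hdM := (abs_lt.1 (hn M ⟨by linarith, le_rfl⟩)).1
      have hdrop : a * M ≤ Λ n 0 - Λ n M := by
        have : D * M ^ 2 = (a + D + 2 * δ) * M := by rw [← hDM]; ring
        nlinarith
      linarith [(hconc n).le_neg_mul_of_drop (hneg n) (by linarith) hdrop hxM]
  refine tendsto_order.2 ⟨fun a ha => ?_, fun b hb => ?_⟩
  · rcases lt_or_ge a 0 with ha0 | ha0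
    · exact Filter.Eventually.of_forall fun n => ha0.trans_le (Real.iInf_nonneg (hpos n))
    · obtain ⟨c, hac, hcs⟩ := exists_between ha
      filter_upwards [lower c (ha0.trans hac.le) hcs] with n hn
      exact hac.trans_le hn
  · have hb0 : 0 < b := by linarith
    have hx : 0 < b / (2 * D) := by positivity
    have hlim := (hconv.tendsto_at (Set.mem_Ici.2 hx.le)).neg.div_const (b / (2 * D))
    refine (hlim.eventually_lt_const (u := b) ?_).mono fun n hn =>
      (ciInf_le ⟨0, Set.forall_mem_range.2 (hpos n)⟩ ⟨b / (2 * D), hx⟩).trans_lt hn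
    rw [div_lt_iff₀ hx]
    have h4 : 4 * D * G < b ^ 2 := by nlinarith
    have hG' : G < b ^ 2 / (4 * D) := by rw [lt_div_iff₀ (by positivity)]; linarith
    have e1 : D * (b / (2 * D)) ^ 2 = b ^ 2 / (4 * D) := by field_simp; norm_num
    have e2 : b * (b / (2 * D)) = 2 * (b ^ 2 / (4 * D)) := by field_simp; norm_num
    linarith
end
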